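/- arXiv:2605.26697 — 4 statements merged into one kernel-verified Lean document; each statement's English description precedes it below -/
import Mathlib

section
/- Let M be an invertible m×m complex matrix and suppose M = W·H where W is a unitary m×m matrix and H is a Hermitian positive definite m×m matrix. Then for every unitary m×m matrix Q one has ‖M − W‖_F ≤ ‖M − Q‖_F, and equality holds only if Q = W. In other words, the polar unitary factor W is the unique nearest unitary matrix to M in Frobenius norm. -/
open Matrix
open scoped ComplexOrder

/-- Frobenius norm of a complex matrix: `‖A‖_F = √(∑ i j, |A i j|²)`. -/
noncomputable def frobNorm {m : ℕ} (A : Matrix (Fin m) (Fin m) ℂ) : ℝ :=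
  Real.sqrt (∑ i, ∑ j, ‖A i j‖ ^ 2)

theorem frobNorm_sq_eq_trace {m : ℕ} (A : Matrix (Fin m) (Fin m) ℂ) :
    ((frobNorm A ^ 2 : ℝ) : ℂ) = (A * Aᴴ).trace := by
  rw [frobNorm, Real.sq_sqrt (by positivity)]
  simp [Matrix.trace, Matrix.mul_apply, Complex.mul_conj']

theorem frobNorm_nonneg {m : ℕ} (A : Matrix (Fin m) (Fin m) ℂ) : 0 ≤ frobNorm A :=
  Real.sqrt_nonneg _

open scoped MatrixOrder in
theorem Matrix.PosDef.eq_zero_of_mul_mul_conjTranspose_eq_zero {m n : Type*} [Fintype n]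
    [DecidableEq n] {H : Matrix n n ℂ} (hH : H.PosDef) {D : Matrix m n ℂ}
    (h : D * H * Dᴴ = 0) : D = 0 := by
  obtain ⟨B, hB⟩ := CStarAlgebra.nonneg_iff_eq_star_mul_self.mp hH.posSemidef.nonneg
  rw [star_eq_conjTranspose] at hB
  have hDB : D * Bᴴ = 0 := by
    rw [← self_mul_conjTranspose_eq_zero, conjTranspose_mul, conjTranspose_conjTranspose, ← h, hB]
    simp only [Matrix.mul_assoc]
  have hDH : D * H = 0 := by rw [hB, ← Matrix.mul_assoc, hDB, Matrix.zero_mul]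
  rw [← mul_nonsing_inv_cancel_right H D ((isUnit_iff_isUnit_det H).mp hH.isUnit), hDH,
    Matrix.zero_mul]

/-- The excess of the squared distance from `W * H` to a unitary `Q` over that to `W` is the
trace of the congruence of `H` by `W - Q`. -/
theorem frobNorm_sq_sub_frobNorm_sq {m : ℕ} {W H Q : Matrix (Fin m) (Fin m) ℂ}
    (hW : Wᴴ * W = 1) (hW' : W * Wᴴ = 1) (hH : H.IsHermitian)
    (hQ : Qᴴ * Q = 1) (hQ' : Q * Qᴴ = 1) :
    ((frobNorm (W * H - Q) ^ 2 - frobNorm (W * H - W) ^ 2 : ℝ) : ℂ) =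
      ((W - Q) * H * (W - Q)ᴴ).trace := by
  have trace_conj {U : Matrix (Fin m) (Fin m) ℂ} (hU : Uᴴ * U = 1) :
      (U * H * Uᴴ).trace = H.trace := by
    rw [trace_mul_comm, ← Matrix.mul_assoc, hU, Matrix.one_mul]
  rw [Complex.ofReal_sub, frobNorm_sq_eq_trace, frobNorm_sq_eq_trace]
  have h₁ := trace_conj hW
  have h₂ := trace_conj hQ
  simp only [conjTranspose_sub, conjTranspose_mul, hH.eq, Matrix.mul_sub, Matrix.sub_mul,
    trace_sub, hW', hQ', ← Matrix.mul_assoc] at *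
  linear_combination h₁ - h₂

/-- The polar unitary factor `W` of an invertible matrix `M = W·H` is the unique
nearest unitary matrix to `M` in Frobenius norm. -/
theorem polar_factor_nearest_unitary {m : ℕ} (M W H : Matrix (Fin m) (Fin m) ℂ)
    (hM : IsUnit M)
    (hWu : Wᴴ * W = 1) (hWu' : W * Wᴴ = 1)
    (hH : H.PosDef)
    (hpolar : M = W * H) :
    ∀ Q : Matrix (Fin m) (Fin m) ℂ, Qᴴ * Q = 1 → Q * Qᴴ = 1 →
      frobNorm (M - W) ≤ frobNorm (M - Q) ∧
        (frobNorm (M - W) = frobNorm (M - Q) → Q = W) := by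
  intro Q hQ hQ'
  subst hpolar
  have key := frobNorm_sq_sub_frobNorm_sq hWu hWu' hH.isHermitian hQ hQ'
  have hpos := hH.posSemidef.mul_mul_conjTranspose_same (W - Q)
  constructor
  · have h := hpos.trace_nonneg
    rw [← key, Complex.zero_le_real, sub_nonneg] at h
    exact le_of_sq_le_sq h (frobNorm_nonneg _)
  · intro heq
    rw [heq, sub_self, Complex.ofReal_zero] at key
    have hzero := hpos.trace_eq_zero_iff.mp key.symm
    exact (sub_eq_zero.mp (hH.eq_zero_of_mul_mul_conjTranspose_eq_zero hzero)).symm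
end

section
/- Let Φ : ℝ → (d×m complex matrices) be differentiable with Φ(t)ᴴ·Φ(t) = 1 for every t, and let c : ℝ → ℂ^m be differentiable. Define ψ(t) = Φ(t).mulVec c(t), and suppose the parallel-transport condition (Φ(t)·Φ(t)ᴴ).mulVec ((deriv ψ)(t)) = 0 holds for every t. Then for every t, (deriv c)(t) = −(Φ(t)ᴴ·(deriv Φ)(t)).mulVec (c(t)); that is, the coefficient vector satisfies the transport equation ċ = −A·c with A the Wilczek–Zee connection. -/
open Matrix

attribute [local instance] Matrix.normedAddCommGroup Matrix.normedSpace

/-- Product rule for the action of a differentiable matrix on a differentiable vector. -/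
theorem HasDerivAt.matrix_mulVec {d m : Type*} [Fintype d] [Fintype m]
    {Φ : ℝ → Matrix d m ℂ} {c : ℝ → m → ℂ} {Φ' : Matrix d m ℂ} {c' : m → ℂ} {t : ℝ}
    (hΦ : HasDerivAt Φ Φ' t) (hc : HasDerivAt c c' t) :
    HasDerivAt (fun s => (Φ s).mulVec (c s)) (Φ'.mulVec (c t) + (Φ t).mulVec c') t := by
  refine hasDerivAt_pi.2 fun i => ?_
  have hrow : HasDerivAt (fun s => Φ s i) (Φ' i) t := hasDerivAt_pi.1 hΦ i
  have hsum := HasDerivAt.fun_sum (u := Finset.univ) fun j _ =>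
    (hasDerivAt_pi.1 hrow j).mul (hasDerivAt_pi.1 hc j)
  simpa [Matrix.mulVec, dotProduct, Finset.sum_add_distrib] using hsum

/-- Projector parallel transport implies the coefficient transport equation
`ċ = −A·c` with `A = Φᴴ·(deriv Φ)` the Wilczek–Zee connection. -/
theorem coefficient_transport_equation {d m : ℕ}
    (Φ : ℝ → Matrix (Fin d) (Fin m) ℂ)
    (c : ℝ → Fin m → ℂ)
    (hΦdiff : Differentiable ℝ Φ)
    (hcdiff : Differentiable ℝ c)
    (hΦ : ∀ t, (Φ t)ᴴ * Φ t = 1)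
    (hpar : ∀ t,
      (Φ t * (Φ t)ᴴ).mulVec (deriv (fun s => (Φ s).mulVec (c s)) t) = 0) :
    ∀ t, deriv c t = -((Φ t)ᴴ * deriv Φ t).mulVec (c t) := by
  intro t
  have h := congrArg (fun v => (Φ t)ᴴ.mulVec v) (hpar t)
  simp only [((hΦdiff t).hasDerivAt.matrix_mulVec (hcdiff t).hasDerivAt).deriv,
    Matrix.mulVec_mulVec, Matrix.mulVec_add, Matrix.mulVec_zero, ← Matrix.mul_assoc, hΦ,
    Matrix.one_mul, Matrix.one_mulVec] at h
  exact eq_neg_of_add_eq_zero_right h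
end

section
/- Let A, U, G : ℝ → (m×m complex matrices) with U and G differentiable, G(t) unitary for every t, U(0) = 1, and (deriv U)(t) = −A(t)·U(t) for every t. Define the gauge-transformed connection A'(t) = G(t)ᴴ·A(t)·G(t) + G(t)ᴴ·(deriv G)(t) and the transformed transport V(t) = G(t)ᴴ·U(t)·G(0). Then V(0) = 1 and (deriv V)(t) = −A'(t)·V(t) for every t; that is, the solution of the transport equation transforms as U(t) ↦ G(t)ᴴ·U(t)·G(0) under a gauge transformation. -/
open Matrix

attribute [local instance] Matrix.normedAddCommGroup Matrix.normedSpace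

/-- A matrix-valued function of a real variable is differentiable iff its entries are. -/
theorem Matrix.hasDerivAt_iff_entries {m n : Type*} [Fintype m] [Fintype n]
    {F : ℝ → Matrix m n ℂ} {F' : Matrix m n ℂ} {t : ℝ} :
    HasDerivAt F F' t ↔ ∀ i j, HasDerivAt (fun s => F s i j) (F' i j) t :=
  hasDerivAt_pi.trans (forall_congr' fun _ => hasDerivAt_pi)

/-- The product rule for matrix-valued functions of a real variable. -/
theorem Matrix.hasDerivAt_mul {l m n : Type*} [Fintype l] [Fintype m] [Fintype n]
    {F : ℝ → Matrix l m ℂ} {H : ℝ → Matrix m n ℂ} {F' : Matrix l m ℂ} {H' : Matrix m n ℂ}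
    {t : ℝ} (hF : HasDerivAt F F' t) (hH : HasDerivAt H H' t) :
    HasDerivAt (fun s => F s * H s) (F' * H t + F t * H') t := by
  rw [Matrix.hasDerivAt_iff_entries] at hF hH ⊢
  intro i j
  simp only [Matrix.add_apply, Matrix.mul_apply, ← Finset.sum_add_distrib]
  exact HasDerivAt.fun_sum fun k _ => (hF i k).fun_mul (hH k j)

/-- The conjugate transpose commutes with differentiation in a real variable. -/
theorem Matrix.hasDerivAt_conjTranspose {m n : Type*} [Fintype m] [Fintype n]
    {F : ℝ → Matrix m n ℂ} {F' : Matrix m n ℂ} {t : ℝ} (hF : HasDerivAt F F' t) :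
    HasDerivAt (fun s => (F s)ᴴ) F'ᴴ t := by
  rw [Matrix.hasDerivAt_iff_entries] at hF ⊢
  exact fun i j => (hF j i).star



/-- Gauge transformation of the transport equation: if `U̇ = −A·U`, `U(0) = 1`,
and `G(t)` is unitary, then `V(t) = G(t)ᴴ·U(t)·G(0)` satisfies `V(0) = 1` and
`V̇ = −A'·V` with `A' = Gᴴ·A·G + Gᴴ·(deriv G)`. -/
theorem transport_gauge_transform {m : ℕ}
    (A U G : ℝ → Matrix (Fin m) (Fin m) ℂ)
    (hUdiff : Differentiable ℝ U)
    (hGdiff : Differentiable ℝ G)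
    (hG : ∀ t, (G t)ᴴ * G t = 1 ∧ G t * (G t)ᴴ = 1)
    (hU0 : U 0 = 1)
    (hU : ∀ t, deriv U t = -(A t) * U t) :
    (fun t => (G t)ᴴ * U t * G 0) 0 = 1 ∧
      ∀ t, deriv (fun s => (G s)ᴴ * U s * G 0) t =
        -((G t)ᴴ * A t * G t + (G t)ᴴ * deriv G t) *
          ((G t)ᴴ * U t * G 0) := by
  refine ⟨by simp [hU0, (hG 0).1], fun t => ?_⟩
  have hGt := (hGdiff t).hasDerivAt
  have hGHt := Matrix.hasDerivAt_conjTranspose hGt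
  have hunit : (deriv G t)ᴴ * G t + (G t)ᴴ * deriv G t = 0 := by
    refine (Matrix.hasDerivAt_mul hGHt hGt).unique ?_
    simp only [(hG _).1]
    exact hasDerivAt_const t 1
  have hstar : (G t)ᴴ * deriv G t * (G t)ᴴ = -(deriv G t)ᴴ := by
    rw [eq_neg_of_add_eq_zero_right hunit, neg_mul, mul_assoc, (hG t).2, mul_one]
  have hUt := (hUdiff t).hasDerivAt.congr_deriv (hU t)
  refine (Matrix.hasDerivAt_mul (Matrix.hasDerivAt_mul hGHt hUt)
    (hasDerivAt_const t (G 0))).deriv.trans ?_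
  calc ((deriv G t)ᴴ * U t + (G t)ᴴ * (-(A t) * U t)) * G 0 + (G t)ᴴ * U t * 0
      = -((G t)ᴴ * A t * 1 + -(deriv G t)ᴴ) * (U t * G 0) := by noncomm_ring
    _ = -((G t)ᴴ * A t * (G t * (G t)ᴴ) + (G t)ᴴ * deriv G t * (G t)ᴴ) * (U t * G 0) := by
      rw [(hG t).2, hstar]
    _ = _ := by noncomm_ring
end

section
/- Let A, U : ℝ → (m×m complex matrices) with U differentiable, suppose A(t)ᴴ = −A(t) for every t, (deriv U)(t) = −A(t)·U(t) for every t, and U(0)ᴴ·U(0) = 1. Then U(t)ᴴ·U(t) = 1 for every t; that is, transport generated by an anti-Hermitian connection preserves unitarity. -/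
open Matrix

attribute [local instance] Matrix.normedAddCommGroup Matrix.normedSpace

/-- Entries of a differentiable matrix-valued function have the entries of its derivative as
derivatives. -/
theorem HasDerivAt.matrix_entry {m n : ℕ} {U : ℝ → Matrix (Fin m) (Fin n) ℂ}
    {U' : Matrix (Fin m) (Fin n) ℂ} {t : ℝ} (h : HasDerivAt U U' t) (i : Fin m) (j : Fin n) :
    HasDerivAt (fun s => U s i j) (U' i j) t :=
  hasDerivAt_pi.1 (hasDerivAt_pi.1 h i) j

/-- Entrywise product rule for `Uᴴ * U`. -/
theorem HasDerivAt.conjTranspose_mul_self_entry {m n : ℕ} {U : ℝ → Matrix (Fin m) (Fin n) ℂ}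
    {U' : Matrix (Fin m) (Fin n) ℂ} {t : ℝ} (h : HasDerivAt U U' t) (i j : Fin n) :
    HasDerivAt (fun s => ((U s)ᴴ * U s) i j) ((U'ᴴ * U t + (U t)ᴴ * U') i j) t := by
  simp only [Matrix.add_apply, Matrix.mul_apply, Matrix.conjTranspose_apply,
    ← Finset.sum_add_distrib]
  exact HasDerivAt.fun_sum fun k _ => (h.matrix_entry k i).star.mul (h.matrix_entry k j)

/-- Transport generated by an anti-Hermitian connection preserves unitarity:
if `Aᴴ = −A`, `U̇ = −A·U`, and `U(0)ᴴ·U(0) = 1`, then `U(t)ᴴ·U(t) = 1` for all `t`. -/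
theorem antiHermitian_transport_preserves_unitarity {m : ℕ}
    (A U : ℝ → Matrix (Fin m) (Fin m) ℂ)
    (hUdiff : Differentiable ℝ U)
    (hA : ∀ t, (A t)ᴴ = -(A t))
    (hU : ∀ t, deriv U t = -(A t) * U t)
    (hU0 : (U 0)ᴴ * U 0 = 1) :
    ∀ t, (U t)ᴴ * U t = 1 := by
  intro t
  ext i j
  rw [← hU0]
  have hderiv (s : ℝ) : HasDerivAt (fun s => ((U s)ᴴ * U s) i j) 0 s := by
    have h := (hUdiff s).hasDerivAt.conjTranspose_mul_self_entry i j
    have hzero : (deriv U s)ᴴ * U s + (U s)ᴴ * deriv U s = 0 := by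
      rw [hU, conjTranspose_mul, conjTranspose_neg, hA, neg_neg, Matrix.mul_assoc,
        ← Matrix.mul_add, ← Matrix.add_mul, add_neg_cancel, Matrix.zero_mul, Matrix.mul_zero]
    exact h.congr_deriv (congrFun₂ hzero i j)
  exact is_const_of_deriv_eq_zero (fun s => (hderiv s).differentiableAt)
    (fun s => (hderiv s).deriv) t 0
end
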